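/- Let d ≥ 1, α > 0 and let f : ℝ^d → ℝ be L_0-Lipschitz. Then the uniform-ball smoothed function f_α is differentiable on ℝ^d, and for every x ∈ ℝ^d, ∇f_α(x) = (d/α)·E[f(x + α·u)·u], where u is uniformly distributed on the unit sphere of ℝ^d. Consequently, since E[u] = 0, for any constant c ∈ ℝ one also has ∇f_α(x) = (d/α)·E[(f(x + α·u) − c)·u]. -/

import Mathlib

open MeasureTheory ProbabilityTheory
open scoped RealInnerProductSpace

noncomputable section

abbrev Euc (d : ℕ) : Type := EuclideanSpace ℝ (Fin d)

/-- Uniform probability distribution on the closed unit ball of `ℝ^d`. -/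
def unifBall (d : ℕ) : Measure (Euc d) :=
  (volume (Metric.closedBall (0 : Euc d) 1))⁻¹ •
    volume.restrict (Metric.closedBall (0 : Euc d) 1)

/-- Uniform (rotation-invariant) probability distribution on the unit sphere of `ℝ^d`,
realized as the pushforward of the uniform ball distribution under normalization. -/
def unifSphere (d : ℕ) : Measure (Euc d) :=
  Measure.map (fun x => ‖x‖⁻¹ • x) (unifBall d)

/-- Uniform-ball smoothed function `f_α(x) = E[f(x + α·ũ)]`, `ũ` uniform on the closed unit ball. -/
def smoothed (d : ℕ) (f : Euc d → ℝ) (α : ℝ) (x : Euc d) : ℝ :=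
  ∫ u, f (x + α • u) ∂(unifBall d)


section Lipschitz

variable {E : Type*} [NormedAddCommGroup E]

lemma LipschitzWith.abs_le_of_norm_le_one {C : NNReal} {g : E → ℝ} (hg : LipschitzWith C g)
    {x : E} (hx : ‖x‖ ≤ 1) : |g x| ≤ |g 0| + C := by
  have h := hg.dist_le_mul x 0
  rw [dist_zero_right, Real.dist_eq] at h
  have h2 : (C : ℝ) * ‖x‖ ≤ C * 1 := by gcongr
  have h3 := abs_sub_abs_le_abs_sub (g x) (g 0)
  linarith

/-- A Lipschitz function vanishing at least linearly at the unit sphere stays Lipschitz when it is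
extended by zero outside the unit ball. -/
lemma LipschitzWith.indicator_ball {C : NNReal} {k : E → ℝ} (hk : LipschitzWith C k)
    (hb : ∀ x, ‖x‖ < 1 → |k x| ≤ C * (1 - ‖x‖)) :
    LipschitzWith C ((Metric.ball 0 1).indicator k) := by
  have key : ∀ x y : E, ‖x‖ < 1 → 1 ≤ ‖y‖ → |k x| ≤ C * dist x y := fun x y hx hy => by
    refine (hb x hx).trans ?_
    gcongr
    rw [dist_eq_norm, norm_sub_rev]
    linarith [norm_sub_norm_le y x]
  refine LipschitzWith.of_dist_le_mul fun x y => ?_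
  by_cases hx : ‖x‖ < 1 <;> by_cases hy : ‖y‖ < 1
  · simpa [Set.indicator, hx, hy] using hk.dist_le_mul x y
  · simpa [Set.indicator, hx, hy, Real.dist_eq] using key x y hx (not_lt.1 hy)
  · simpa [Set.indicator, hx, hy, Real.dist_eq, dist_comm] using key y x hy (not_lt.1 hx)
  · simp [Set.indicator, hx, hy]; positivity

lemma lipschitzWith_max_one_sub_norm :
    LipschitzWith 1 (fun x : E => max (1 - ‖x‖) 0) := by
  have h : LipschitzWith 1 (fun x : E => 1 - ‖x‖) := by
    refine LipschitzWith.of_dist_le_mul fun x y => ?_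
    rw [Real.dist_eq, dist_eq_norm, NNReal.coe_one, one_mul, norm_sub_rev]
    simpa using abs_norm_sub_norm_le y x
  exact h.max_const 0

end Lipschitz

section Homogeneous

variable {E : Type*} [NormedAddCommGroup E] [NormedSpace ℝ E]

/-- The positively `1`-homogeneous function that agrees with `g` on the unit sphere. -/
def homogeneousExtension (g : E → ℝ) (x : E) : ℝ := ‖x‖ * g (‖x‖⁻¹ • x)

lemma norm_smul_normalized (x : E) : ‖x‖ • (‖x‖⁻¹ • x) = x := by
  rcases eq_or_ne x 0 with rfl | hx
  · simp
  · rw [smul_smul, mul_inv_cancel₀ (norm_ne_zero_iff.2 hx), one_smul]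

lemma norm_normalized_le_one (x : E) : ‖‖x‖⁻¹ • x‖ ≤ 1 := by
  rw [norm_smul, norm_inv, norm_norm]
  exact inv_mul_le_one

lemma normalized_smul {t : ℝ} (ht : 0 < t) (x : E) : ‖t • x‖⁻¹ • (t • x) = ‖x‖⁻¹ • x := by
  rw [norm_smul, Real.norm_of_nonneg ht.le, smul_smul]
  congr 1
  field_simp

lemma norm_mul_norm_normalized_sub_le (x y : E) :
    ‖y‖ * ‖‖x‖⁻¹ • x - ‖y‖⁻¹ • y‖ ≤ 2 * ‖x - y‖ := by
  have h : ‖y‖ • (‖x‖⁻¹ • x - ‖y‖⁻¹ • y) = (‖y‖ - ‖x‖) • (‖x‖⁻¹ • x) + (x - y) := by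
    rw [smul_sub, sub_smul, norm_smul_normalized, norm_smul_normalized]
    abel
  calc ‖y‖ * ‖‖x‖⁻¹ • x - ‖y‖⁻¹ • y‖ = ‖‖y‖ • (‖x‖⁻¹ • x - ‖y‖⁻¹ • y)‖ := by
        rw [norm_smul, norm_norm]
    _ ≤ ‖‖y‖ - ‖x‖‖ * ‖‖x‖⁻¹ • x‖ + ‖x - y‖ := by
        rw [h, ← norm_smul]; exact norm_add_le _ _
    _ ≤ ‖x - y‖ * 1 + ‖x - y‖ := by
        gcongr
        · rw [norm_sub_rev x y]; exact abs_norm_sub_norm_le y x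
        · exact norm_normalized_le_one x
    _ = 2 * ‖x - y‖ := by ring

lemma LipschitzWith.homogeneousExtension {C : NNReal} {g : E → ℝ} (hg : LipschitzWith C g) :
    LipschitzWith (‖g 0‖₊ + 3 * C) (homogeneousExtension g) := by
  refine LipschitzWith.of_dist_le_mul fun x y => ?_
  rw [Real.dist_eq, dist_eq_norm]
  push_cast
  rw [Real.norm_eq_abs]
  have h1 := hg.abs_le_of_norm_le_one (norm_normalized_le_one x)
  have h2 := hg.dist_le_mul (‖x‖⁻¹ • x) (‖y‖⁻¹ • y)
  rw [Real.dist_eq, dist_eq_norm] at h2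
  have h3 := norm_mul_norm_normalized_sub_le x y
  have h4 := abs_norm_sub_norm_le x y
  calc |_root_.homogeneousExtension g x - _root_.homogeneousExtension g y|
      = |(‖x‖ - ‖y‖) * g (‖x‖⁻¹ • x) + ‖y‖ * (g (‖x‖⁻¹ • x) - g (‖y‖⁻¹ • y))| := by
        unfold _root_.homogeneousExtension; congr 1; ring
    _ ≤ |‖x‖ - ‖y‖| * |g (‖x‖⁻¹ • x)| + ‖y‖ * |g (‖x‖⁻¹ • x) - g (‖y‖⁻¹ • y)| := by
        refine (abs_add_le _ _).trans_eq ?_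
        rw [abs_mul, abs_mul, abs_norm]
    _ ≤ ‖x - y‖ * (|g 0| + C) + ‖y‖ * (C * ‖‖x‖⁻¹ • x - ‖y‖⁻¹ • y‖) := by gcongr
    _ = ‖x - y‖ * (|g 0| + C) + C * (‖y‖ * ‖‖x‖⁻¹ • x - ‖y‖⁻¹ • y‖) := by ring
    _ ≤ ‖x - y‖ * (|g 0| + C) + C * (2 * ‖x - y‖) := by gcongr
    _ = (|g 0| + 3 * C) * ‖x - y‖ := by ring

lemma homogeneousExtension_smul (g : E → ℝ) {t : ℝ} (ht : 0 < t) (x : E) :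
    homogeneousExtension g (t • x) = t * homogeneousExtension g x := by
  unfold homogeneousExtension
  rw [normalized_smul ht, norm_smul, Real.norm_of_nonneg ht.le, mul_assoc]

lemma lineDeriv_smul_of_homogeneous {H : E → ℝ}
    (hH : ∀ t : ℝ, 0 < t → ∀ x, H (t • x) = t * H x) {t : ℝ} (ht : 0 < t) (x v : E) :
    lineDeriv ℝ H (t • x) v = lineDeriv ℝ H x v := by
  have h : (fun s : ℝ => H (t • x + s • v)) = fun s => t * H (x + (t⁻¹ * s) • v) := by
    ext s
    rw [← hH t ht, smul_add, smul_smul, mul_inv_cancel_left₀ ht.ne']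
  unfold lineDeriv
  rw [h, deriv_const_mul_field, deriv_comp_mul_left t⁻¹ (fun s : ℝ => H (x + s • v))]
  simp [ht.ne']

lemma abs_sub_homogeneousExtension_le {C : NNReal} {g : E → ℝ} (hg : LipschitzWith C g)
    {x : E} (hx : ‖x‖ ≤ 1) :
    |g x - homogeneousExtension g x| ≤ (|g 0| + 2 * C) * (1 - ‖x‖) := by
  have h1 := hg.abs_le_of_norm_le_one hx
  have h2 := hg.dist_le_mul x (‖x‖⁻¹ • x)
  rw [Real.dist_eq, dist_eq_norm] at h2
  have h3 : ‖x‖ * ‖x - ‖x‖⁻¹ • x‖ = (1 - ‖x‖) * ‖x‖ := by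
    rw [← norm_norm x, ← norm_smul, norm_norm, smul_sub, norm_smul_normalized, norm_sub_rev]
    nth_rewrite 1 [← one_smul ℝ x]
    rw [← sub_smul, norm_smul, Real.norm_of_nonneg (sub_nonneg.2 hx)]
  have h4 := sub_nonneg.2 hx
  calc |g x - homogeneousExtension g x|
      = |(1 - ‖x‖) * g x + ‖x‖ * (g x - g (‖x‖⁻¹ • x))| := by
        unfold homogeneousExtension; congr 1; ring
    _ ≤ (1 - ‖x‖) * |g x| + ‖x‖ * |g x - g (‖x‖⁻¹ • x)| := by
        refine (abs_add_le _ _).trans_eq ?_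
        rw [abs_mul, abs_mul, abs_norm, abs_of_nonneg h4]
    _ ≤ (1 - ‖x‖) * (|g 0| + C) + ‖x‖ * (C * ‖x - ‖x‖⁻¹ • x‖) := by gcongr
    _ = (1 - ‖x‖) * (|g 0| + C) + C * ((1 - ‖x‖) * ‖x‖) := by rw [← h3]; ring
    _ ≤ (1 - ‖x‖) * (|g 0| + C) + C * ((1 - ‖x‖) * 1) := by gcongr
    _ = (|g 0| + 2 * C) * (1 - ‖x‖) := by ring

end Homogeneous

section Polar

open Set Metric

variable {E : Type*} [NormedAddCommGroup E] [NormedSpace ℝ E] [MeasurableSpace E] [BorelSpace E]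
  [FiniteDimensional ℝ E] [Nontrivial E] (μ : Measure E) [μ.IsAddHaarMeasure]

/-- Polar coordinates for the product of a `0`-homogeneous function and a radial function. -/
lemma integral_mul_radial_of_homogeneous {P : E → ℝ}
    (hP : ∀ t : ℝ, 0 < t → ∀ x, P (t • x) = P x) (φ : ℝ → ℝ) :
    ∫ x, P x * φ ‖x‖ ∂μ = (∫ s : sphere (0 : E) 1, P s ∂μ.toSphere) *
      ∫ r in Ioi (0 : ℝ), r ^ (Module.finrank ℝ E - 1) * φ r := by
  calc
    ∫ x, P x * φ ‖x‖ ∂μ = ∫ x : ({(0)}ᶜ : Set E), P x.1 * φ ‖x.1‖ ∂(μ.comap (↑)) := by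
      rw [integral_subtype_comap (measurableSet_singleton _).compl fun x ↦ P x * φ (‖x‖),
        restrict_compl_singleton]
    _ = ∫ x, P x.1 * φ x.2 ∂μ.toSphere.prod (.volumeIoiPow (Module.finrank ℝ E - 1)) := by
      rw [← μ.measurePreserving_homeomorphUnitSphereProd.integral_comp
        (Homeomorph.measurableEmbedding _)]
      refine integral_congr_ae (.of_forall fun x => ?_)
      have hx : 0 < ‖x.1‖⁻¹ := inv_pos.2 (norm_pos_iff.2 x.2)
      simp [hP _ hx]
    _ = (∫ s : sphere (0 : E) 1, P s ∂μ.toSphere) *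
        ∫ r : Ioi (0 : ℝ), φ r ∂.volumeIoiPow (Module.finrank ℝ E - 1) :=
      integral_prod_mul (fun s : sphere (0 : E) 1 => P s) (fun r : Ioi (0 : ℝ) => φ r)
    _ = _ := by
      simp only [Measure.volumeIoiPow, ENNReal.ofReal]
      rw [integral_withDensity_eq_integral_smul,
        integral_subtype_comap measurableSet_Ioi
          fun a ↦ Real.toNNReal (a ^ (Module.finrank ℝ E - 1)) • φ a,
        setIntegral_congr_fun measurableSet_Ioi fun x hx ↦ ?_]
      · rw [NNReal.smul_def, Real.coe_toNNReal _ (pow_nonneg hx.out.le _), smul_eq_mul]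
      · exact (measurable_subtype_coe.pow_const _).real_toNNReal

lemma setIntegral_Ioi_mul_of_eq_indicator {φ ψ : ℝ → ℝ} (h : φ = (Iic 1).indicator ψ) (n : ℕ) :
    ∫ r in Ioi (0 : ℝ), r ^ n * φ r = ∫ r in (0 : ℝ)..1, r ^ n * ψ r := by
  rw [intervalIntegral.integral_of_le zero_le_one, ← Ioi_inter_Iic, inter_comm,
    ← Measure.restrict_restrict measurableSet_Iic, ← integral_indicator measurableSet_Iic, h]
  congr 1 with r
  by_cases hr : r ≤ 1 <;> simp [hr]

lemma setIntegral_closedBall_of_homogeneous {P : E → ℝ}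
    (hP : ∀ t : ℝ, 0 < t → ∀ x, P (t • x) = P x) :
    ∫ x in closedBall 0 1, P x ∂μ =
      (∫ s : sphere (0 : E) 1, P s ∂μ.toSphere) * (Module.finrank ℝ E : ℝ)⁻¹ := by
  have h := integral_mul_radial_of_homogeneous μ hP ((Iic 1).indicator 1)
  rw [setIntegral_Ioi_mul_of_eq_indicator rfl] at h
  rw [← integral_indicator measurableSet_closedBall]
  convert h using 2
  · ext x
    by_cases hx : ‖x‖ ≤ 1 <;> simp [hx]
  · simp [Nat.cast_pred (Module.finrank_pos (R := ℝ) (M := E))]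

lemma setIntegral_closedBall_norm_mul_of_homogeneous {P : E → ℝ}
    (hP : ∀ t : ℝ, 0 < t → ∀ x, P (t • x) = P x) :
    ∫ x in closedBall 0 1, ‖x‖ * P x ∂μ =
      (∫ s : sphere (0 : E) 1, P s ∂μ.toSphere) * ((Module.finrank ℝ E : ℝ) + 1)⁻¹ := by
  have h := integral_mul_radial_of_homogeneous μ hP ((Iic 1).indicator id)
  rw [setIntegral_Ioi_mul_of_eq_indicator rfl] at h
  rw [← integral_indicator measurableSet_closedBall]
  convert h using 2
  · ext x
    by_cases hx : ‖x‖ ≤ 1 <;> simp [hx, mul_comm]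
  · simp [← pow_succ, Nat.sub_add_cancel (Module.finrank_pos (R := ℝ) (M := E))]

lemma integral_mul_max_one_sub_norm_of_homogeneous {P : E → ℝ}
    (hP : ∀ t : ℝ, 0 < t → ∀ x, P (t • x) = P x) :
    ∫ x, P x * max (1 - ‖x‖) 0 ∂μ = (∫ s : sphere (0 : E) 1, P s ∂μ.toSphere) *
      ((Module.finrank ℝ E : ℝ)⁻¹ - ((Module.finrank ℝ E : ℝ) + 1)⁻¹) := by
  have hφ : (fun r : ℝ => max (1 - r) 0) = (Iic 1).indicator (fun r => 1 - r) := by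
    ext r
    by_cases hr : r ≤ 1
    · simp [hr]
    · simp [hr, (not_le.1 hr).le]
  rw [integral_mul_radial_of_homogeneous μ hP (fun r => max (1 - r) 0),
    setIntegral_Ioi_mul_of_eq_indicator hφ]
  congr 1
  simp_rw [mul_sub, mul_one, ← pow_succ]
  rw [intervalIntegral.integral_sub (by simp) (by simp)]
  simp [Nat.cast_pred (Module.finrank_pos (R := ℝ) (M := E)),
    Nat.sub_add_cancel (Module.finrank_pos (R := ℝ) (M := E)),
    (Module.finrank_pos (R := ℝ) (M := E)).ne']

end Polar

section Divergence

open Set Metric Filter Topology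

variable {E : Type*} [NormedAddCommGroup E] [InnerProductSpace ℝ E]

lemma hasLineDerivAt_norm {x : E} (hx : x ≠ 0) (v : E) :
    HasLineDerivAt ℝ (fun y : E => ‖y‖) ⟪‖x‖⁻¹ • x, v⟫ x v := by
  have h1 : HasDerivAt (fun t : ℝ => x + t • v) v 0 := by
    simpa using ((hasDerivAt_id (0 : ℝ)).smul_const v).const_add x
  have h2 := h1.norm_sq.sqrt (by simpa using hx)
  simp only [Real.sqrt_sq (norm_nonneg _), zero_smul, add_zero] at h2
  unfold HasLineDerivAt
  have h3 : ⟪‖x‖⁻¹ • x, v⟫ = 2 * ⟪x, v⟫ / (2 * ‖x‖) := by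
    rw [real_inner_smul_left]
    field_simp
  rwa [h3]

lemma lineDeriv_max_one_sub_norm {x : E} (h0 : x ≠ 0) (h1 : ‖x‖ ≠ 1) (v : E) :
    lineDeriv ℝ (fun y : E => max (1 - ‖y‖) 0) x v =
      (closedBall (0 : E) 1).indicator (fun y => -⟪‖y‖⁻¹ • y, v⟫) x := by
  rcases lt_or_gt_of_ne h1 with h | h
  · have hev : (fun y : E => max (1 - ‖y‖) 0) =ᶠ[𝓝 x] fun y => 1 - ‖y‖ := by
      filter_upwards [continuous_norm.continuousAt.eventually_lt_const h] with y hy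
      exact max_eq_left (by linarith)
    rw [hev.lineDeriv_eq]
    have hd : HasLineDerivAt ℝ (fun y : E => 1 - ‖y‖) (-⟪‖x‖⁻¹ • x, v⟫) x v :=
      HasDerivAt.const_sub 1 (hasLineDerivAt_norm h0 v)
    simp [hd.lineDeriv, h.le]
  · have hev : (fun y : E => max (1 - ‖y‖) 0) =ᶠ[𝓝 x] fun _ => 0 := by
      filter_upwards [continuous_norm.continuousAt.eventually_const_lt h] with y hy
      exact max_eq_right (by linarith)
    rw [hev.lineDeriv_eq]
    simp [h, lineDeriv]

variable [MeasurableSpace E] [BorelSpace E] [FiniteDimensional ℝ E]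
  (μ : Measure E) [μ.IsAddHaarMeasure]

lemma integral_lineDeriv_eq_zero {C : NNReal} {k : E → ℝ} (hk : LipschitzWith C k)
    (hc : HasCompactSupport k) (v : E) : ∫ x, lineDeriv ℝ k x v ∂μ = 0 := by
  have h := (LipschitzWith.const (α := E) (1 : ℝ)).integral_lineDeriv_mul_eq (μ := μ) hk hc (-v)
  simpa [lineDeriv] using h.symm

lemma LipschitzWith.integrableOn_lineDeriv {C : NNReal} {k : E → ℝ} (hk : LipschitzWith C k)
    (v : E) : IntegrableOn (fun x => lineDeriv ℝ k x v) (closedBall 0 1) μ :=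
  (hk.locallyIntegrable_lineDeriv v).integrableOn_isCompact (isCompact_closedBall 0 1)

variable [Nontrivial E]

lemma ae_norm_ne_one : ∀ᵐ x ∂μ, ‖x‖ ≠ 1 := by
  rw [ae_iff]
  convert Measure.addHaar_sphere μ (0 : E) 1 using 2
  ext x
  simp

lemma ae_ne_zero : ∀ᵐ x : E ∂μ, x ≠ 0 := by
  simp [ae_iff]

lemma setIntegral_lineDeriv_homogeneousExtension {C : NNReal} {g : E → ℝ} (hg : LipschitzWith C g)
    (v : E) :
    ∫ x in closedBall 0 1, lineDeriv ℝ (homogeneousExtension g) x v ∂μ =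
      Module.finrank ℝ E *
        ∫ x in closedBall 0 1, g (‖x‖⁻¹ • x) * ⟪‖x‖⁻¹ • x, v⟫ ∂μ := by
  have hd : (0 : ℝ) < Module.finrank ℝ E := Nat.cast_pos.2 Module.finrank_pos
  have hP : ∀ t : ℝ, 0 < t → ∀ x, lineDeriv ℝ (homogeneousExtension g) (t • x) v =
      lineDeriv ℝ (homogeneousExtension g) x v := fun t ht x =>
    lineDeriv_smul_of_homogeneous (fun _ hs y => homogeneousExtension_smul g hs y) ht x v
  have hQ : ∀ t : ℝ, 0 < t → ∀ x : E, g (‖t • x‖⁻¹ • (t • x)) * ⟪‖t • x‖⁻¹ • (t • x), v⟫ =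
      g (‖x‖⁻¹ • x) * ⟪‖x‖⁻¹ • x, v⟫ := fun t ht x => by
    rw [normalized_smul ht]
  have hcs : HasCompactSupport (fun x : E => max (1 - ‖x‖) 0) := by
    refine HasCompactSupport.intro (isCompact_closedBall 0 1) fun x hx => max_eq_right ?_
    rw [mem_closedBall_zero_iff, not_le] at hx
    linarith
  have key := hg.homogeneousExtension.integral_lineDeriv_mul_eq (μ := μ)
    lipschitzWith_max_one_sub_norm hcs v
  have hr : ∫ x, lineDeriv ℝ (fun x : E => max (1 - ‖x‖) 0) x (-v) *
      homogeneousExtension g x ∂μ =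
      ∫ x in closedBall 0 1, ‖x‖ * (g (‖x‖⁻¹ • x) * ⟪‖x‖⁻¹ • x, v⟫) ∂μ := by
    rw [← integral_indicator measurableSet_closedBall]
    refine integral_congr_ae ?_
    filter_upwards [ae_norm_ne_one μ, ae_ne_zero μ] with x h1 h0
    rw [lineDeriv_max_one_sub_norm h0 h1]
    by_cases h : x ∈ closedBall (0 : E) 1
    · simp only [indicator_of_mem h, homogeneousExtension, inner_neg_right]
      ring
    · simp [indicator_of_notMem h]
  rw [hr, integral_mul_max_one_sub_norm_of_homogeneous μ hP,
    setIntegral_closedBall_norm_mul_of_homogeneous μ hQ] at key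
  rw [setIntegral_closedBall_of_homogeneous μ hP, setIntegral_closedBall_of_homogeneous μ hQ]
  field_simp at key ⊢
  linarith

lemma setIntegral_lineDeriv_eq_homogeneousExtension {C : NNReal} {g : E → ℝ}
    (hg : LipschitzWith C g) (v : E) :
    ∫ x in closedBall 0 1, lineDeriv ℝ g x v ∂μ =
      ∫ x in closedBall 0 1, lineDeriv ℝ (homogeneousExtension g) x v ∂μ := by
  have hH := hg.homogeneousExtension
  have hk : LipschitzWith (C + (‖g 0‖₊ + 3 * C)) ((ball 0 1).indicator
      fun x => g x - homogeneousExtension g x) := by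
    refine (hg.sub hH).indicator_ball fun x hx => ?_
    refine (abs_sub_homogeneousExtension_le hg hx.le).trans ?_
    gcongr
    push_cast
    rw [Real.norm_eq_abs]
    linarith [C.coe_nonneg]
  have hc : HasCompactSupport ((ball 0 1).indicator
      fun x => g x - homogeneousExtension g x) :=
    HasCompactSupport.intro (isCompact_closedBall (0 : E) 1) fun x hx =>
      indicator_of_notMem (fun h => hx (ball_subset_closedBall h)) _
  rw [← sub_eq_zero, ← integral_sub (hg.integrableOn_lineDeriv μ v)
    (hH.integrableOn_lineDeriv μ v), ← integral_indicator measurableSet_closedBall,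
    ← integral_lineDeriv_eq_zero μ hk hc v]
  refine integral_congr_ae ?_
  filter_upwards [ae_norm_ne_one μ, hg.ae_lineDifferentiableAt (μ := μ) v,
    hH.ae_lineDifferentiableAt (μ := μ) v] with x h1 hgx hHx
  rcases lt_or_gt_of_ne h1 with h | h
  · have hx : x ∈ ball (0 : E) 1 := by simpa using h
    have hev : (ball 0 1).indicator (fun x => g x - homogeneousExtension g x) =ᶠ[𝓝 x]
        fun x => g x - homogeneousExtension g x := by
      filter_upwards [isOpen_ball.mem_nhds hx] with y hy
      exact indicator_of_mem hy _
    have hd : HasLineDerivAt ℝ (fun x => g x - homogeneousExtension g x)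
        (lineDeriv ℝ g x v - lineDeriv ℝ (homogeneousExtension g) x v) x v :=
      HasDerivAt.sub hgx.hasLineDerivAt hHx.hasLineDerivAt
    rw [hev.lineDeriv_eq, hd.lineDeriv, indicator_of_mem (ball_subset_closedBall hx)]
  · have hev : (ball 0 1).indicator (fun x => g x - homogeneousExtension g x) =ᶠ[𝓝 x]
        fun _ => 0 := by
      filter_upwards [continuous_norm.continuousAt.eventually_const_lt h] with y hy
      exact indicator_of_notMem (by simpa using hy.le) _
    rw [hev.lineDeriv_eq]
    simp [h, lineDeriv]

/-- The divergence theorem on the unit ball for the field `g • v`, with the surface integral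
written as an integral over the ball of a `0`-homogeneous function. -/
lemma LipschitzWith.setIntegral_lineDeriv_closedBall {C : NNReal} {g : E → ℝ}
    (hg : LipschitzWith C g) (v : E) :
    ∫ x in closedBall 0 1, lineDeriv ℝ g x v ∂μ =
      Module.finrank ℝ E *
        ∫ x in closedBall 0 1, g (‖x‖⁻¹ • x) * ⟪‖x‖⁻¹ • x, v⟫ ∂μ := by
  rw [setIntegral_lineDeriv_eq_homogeneousExtension μ hg v,
    setIntegral_lineDeriv_homogeneousExtension μ hg v]

end Divergence

section Smoothing

open Metric

instance (d : ℕ) : IsProbabilityMeasure (unifBall d) where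
  measure_univ := by
    rw [unifBall, Measure.smul_apply, Measure.restrict_apply_univ, smul_eq_mul]
    exact ENNReal.inv_mul_cancel (measure_closedBall_pos volume _ one_pos).ne'
      measure_closedBall_lt_top.ne

lemma unifBall_absolutelyContinuous (d : ℕ) : unifBall d ≪ volume :=
  Measure.absolutelyContinuous_of_le_smul (c := (volume (closedBall (0 : Euc d) 1))⁻¹)
    (by unfold unifBall; gcongr; exact Measure.restrict_le_self)

lemma ae_unifBall_norm_le_one (d : ℕ) : ∀ᵐ u ∂unifBall d, ‖u‖ ≤ 1 := by
  refine Measure.ae_smul_measure ?_ _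
  filter_upwards [ae_restrict_mem measurableSet_closedBall] with u hu
  simpa using hu

lemma measurable_normalized (d : ℕ) : Measurable fun x : Euc d => ‖x‖⁻¹ • x := by
  fun_prop

instance (d : ℕ) : IsProbabilityMeasure (unifSphere d) :=
  Measure.isProbabilityMeasure_map (measurable_normalized d).aemeasurable

lemma ae_unifSphere_norm_le_one (d : ℕ) : ∀ᵐ u ∂unifSphere d, ‖u‖ ≤ 1 := by
  rw [unifSphere, ae_map_iff (measurable_normalized d).aemeasurable
    (measurableSet_le measurable_norm measurable_const)]
  exact .of_forall norm_normalized_le_one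

lemma Continuous.integrable_of_ae_norm_le_one {d : ℕ} {F : Type*} [NormedAddCommGroup F]
    {h : Euc d → F} (hh : Continuous h) {ν : Measure (Euc d)} [IsFiniteMeasure ν]
    (hν : ∀ᵐ u ∂ν, ‖u‖ ≤ 1) : Integrable h ν := by
  obtain ⟨M, hM⟩ := (isCompact_closedBall (0 : Euc d) 1).exists_bound_of_continuousOn
    hh.continuousOn
  refine Integrable.of_bound hh.aestronglyMeasurable M ?_
  filter_upwards [hν] with u hu using hM u (by simpa using hu)

/-- The divergence theorem on the unit ball for the field `g • v`. -/
lemma LipschitzWith.integral_lineDeriv_unifBall {d : ℕ} (hd : 1 ≤ d) {C : NNReal}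
    {g : Euc d → ℝ} (hg : LipschitzWith C g) (v : Euc d) :
    ∫ u, lineDeriv ℝ g u v ∂unifBall d = d * ∫ u, g u * ⟪u, v⟫ ∂unifSphere d := by
  have : Nonempty (Fin d) := ⟨⟨0, hd⟩⟩
  have hc := hg.continuous
  rw [unifSphere, integral_map (measurable_normalized d).aemeasurable
    (by fun_prop : Continuous fun u => g u * ⟪u, v⟫).aestronglyMeasurable, unifBall,
    integral_smul_measure, integral_smul_measure, hg.setIntegral_lineDeriv_closedBall volume,
    finrank_euclideanSpace_fin, smul_eq_mul, smul_eq_mul]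
  ring

lemma LipschitzWith.hasGradientAt_smoothed {d : ℕ} (hd : 1 ≤ d) {α : ℝ} (hα : 0 < α) {C : NNReal}
    {f : Euc d → ℝ} (hf : LipschitzWith C f) (x : Euc d) :
    HasGradientAt (smoothed d f α)
      (((d : ℝ) / α) • ∫ u, f (x + α • u) • u ∂(unifSphere d)) x := by
  have hfc := hf.continuous
  set g : Euc d → ℝ := fun u => f (x + α • u) with hg
  have hgl : LipschitzWith (C * α.toNNReal) g := by
    refine LipschitzWith.of_dist_le_mul fun u w => ?_
    have h := hf.dist_le_mul (x + α • u) (x + α • w)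
    rw [dist_add_left, dist_smul₀, Real.norm_of_nonneg hα.le, ← mul_assoc] at h
    simpa [hα.le] using h
  have hfg : ∀ u y, f (y + α • u) = g (u + α⁻¹ • (y - x)) := fun u y => by
    simp only [hg, smul_add, smul_smul, mul_inv_cancel₀ hα.ne', one_smul]
    congr 1
    abel
  have hdiff : ∀ᵐ u ∂unifBall d, DifferentiableAt ℝ g u :=
    (unifBall_absolutelyContinuous d).ae_le hgl.ae_differentiableAt
  obtain ⟨hderInt, hder⟩ := hasFDerivAt_integral_of_dominated_loc_of_lip
    (μ := unifBall d) (F := fun y u => f (y + α • u)) (F' := fun u => α⁻¹ • fderiv ℝ g u)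
    (x₀ := x) (s := Set.univ) (bound := fun _ => C) Filter.univ_mem
    (.of_forall fun y => (by fun_prop : Continuous fun u => f (y + α • u)).aestronglyMeasurable)
    (hgl.continuous.integrable_of_ae_norm_le_one (ae_unifBall_norm_le_one d))
    ((measurable_fderiv ℝ g).const_smul α⁻¹).aestronglyMeasurable
    (.of_forall fun u => LipschitzOnWith.of_dist_le_mul fun y _ z _ => by
      simpa using hf.dist_le_mul (y + α • u) (z + α • u))
    (integrable_const _) (by
      filter_upwards [hdiff] with u hu
      simp only [hfg]
      have h1 : HasFDerivAt (fun y => u + α⁻¹ • (y - x))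
          (α⁻¹ • ContinuousLinearMap.id ℝ (Euc d)) x :=
        (((hasFDerivAt_id x).sub_const x).const_smul α⁻¹).const_add u
      have h2 : HasFDerivAt g (fderiv ℝ g u) (u + α⁻¹ • (x - x)) := by
        simpa using hu.hasFDerivAt
      simpa [Function.comp_def] using h2.comp x h1)
  rw [hasGradientAt_iff_hasFDerivAt]
  refine hder.congr_fderiv ?_
  ext v
  have hgv : Integrable (fun u => g u • u) (unifSphere d) :=
    (hgl.continuous.smul continuous_id).integrable_of_ae_norm_le_one
      (ae_unifSphere_norm_le_one d)
  rw [ContinuousLinearMap.integral_apply hderInt, InnerProductSpace.toDual_apply_apply,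
    real_inner_smul_left, real_inner_comm, ← integral_inner hgv]
  simp only [smul_apply, smul_eq_mul, real_inner_smul_right]
  rw [integral_const_mul]
  have h := hgl.integral_lineDeriv_unifBall hd v
  rw [integral_congr_ae (g := fun u => fderiv ℝ g u v)
    (hdiff.mono fun u hu => hu.lineDeriv_eq_fderiv)] at h
  rw [h]
  simp only [real_inner_comm]
  ring

end Smoothing

/-- For `L₀`-Lipschitz `f`, the smoothed function `f_α` is differentiable with gradient
`∇f_α(x) = (d/α)·E_{u ∼ sphere}[f(x + α·u)·u]`, and the same holds with any constant `c`
subtracted from the function values. -/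
theorem stmt_2 (d : ℕ) (hd : 1 ≤ d) (α : ℝ) (hα : 0 < α) (L₀ : ℝ)
    (f : Euc d → ℝ) (hLip : ∀ x y, |f x - f y| ≤ L₀ * ‖x - y‖) :
    Differentiable ℝ (smoothed d f α) ∧
    (∀ x, gradient (smoothed d f α) x
        = ((d : ℝ) / α) • ∫ u, f (x + α • u) • u ∂(unifSphere d)) ∧
    (∀ x (c : ℝ), gradient (smoothed d f α) x
        = ((d : ℝ) / α) • ∫ u, (f (x + α • u) - c) • u ∂(unifSphere d)) := by
  have hf : ∀ c : ℝ, LipschitzWith L₀.toNNReal fun y => f y - c := fun c =>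
    LipschitzWith.of_dist_le' fun x y => by
      simpa [Real.dist_eq, dist_eq_norm] using hLip x y
  have hf0 : LipschitzWith L₀.toNNReal f := by simpa using hf 0
  refine ⟨fun x => (hf0.hasGradientAt_smoothed hd hα x).differentiableAt,
    fun x => (hf0.hasGradientAt_smoothed hd hα x).gradient, fun x c => ?_⟩
  have hs : smoothed d (fun y => f y - c) α = fun y => smoothed d f α y - c := by
    ext y
    have hc := hf0.continuous
    unfold smoothed
    rw [integral_sub ((by fun_prop : Continuous fun u => f (y + α • u)).integrable_of_ae_norm_le_one
      (ae_unifBall_norm_le_one d)) (integrable_const c)]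
    simp
  rw [← ((hf c).hasGradientAt_smoothed hd hα x).gradient, hs]
  simp [gradient, fderiv_sub_const]
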